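/- Let n ≥ 1 and m ∈ (0,1). Let u and v be classical solutions of the fast diffusion equation on ℝⁿ × (0,∞) such that for every compact set K ⊂ ℝⁿ one has lim_{t→0⁺} ∫_K |u(x,t) − v(x,t)| dx = 0. Then u(x,t) = v(x,t) for all (x,t) ∈ ℝⁿ × (0,∞). -/

import Mathlib

open MeasureTheory

/-- The Euclidean Laplacian: trace of the second derivative, computed as the sum of the
second directional derivatives along the standard orthonormal basis. -/
noncomputable def laplacian {n : ℕ} (f : EuclideanSpace ℝ (Fin n) → ℝ)
    (x : EuclideanSpace ℝ (Fin n)) : ℝ :=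
  ∑ i : Fin n,
    fderiv ℝ (fun y => fderiv ℝ f y (EuclideanSpace.single i 1)) x (EuclideanSpace.single i 1)

open Filter Topology

section Laplacian

variable {n : ℕ}

local notation "𝔼" => EuclideanSpace ℝ (Fin n)

theorem ContDiff.fderiv_apply_const {k l : WithTop ℕ∞} {f : 𝔼 → ℝ} (hf : ContDiff ℝ k f)
    (hkl : l + 1 ≤ k) (w : 𝔼) : ContDiff ℝ l (fun y => fderiv ℝ f y w) :=
  (hf.fderiv_right hkl).clm_apply contDiff_const

theorem HasCompactSupport.fderiv_apply_const {f : 𝔼 → ℝ} (hf : HasCompactSupport f) (w : 𝔼) :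
    HasCompactSupport (fun y => fderiv ℝ f y w) :=
  hf.fderiv_apply ℝ w

theorem ContDiff.continuous_laplacian {f : 𝔼 → ℝ} (hf : ContDiff ℝ 2 f) :
    Continuous (laplacian f) := by
  unfold laplacian
  refine continuous_finsetSum _ fun i _ => ?_
  exact ((hf.fderiv_apply_const (l := 1) (by norm_num) _).fderiv_apply_const
    (l := 0) (by norm_num) _).continuous

theorem HasCompactSupport.laplacian_eq_zero {f : 𝔼 → ℝ} {x : 𝔼} (hx : x ∉ tsupport f) :
    laplacian f x = 0 := by
  unfold laplacian
  refine Finset.sum_eq_zero fun i _ => ?_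
  have h : ∀ (g : 𝔼 → ℝ) (w : 𝔼), tsupport (fun y => fderiv ℝ g y w) ⊆ tsupport g :=
    fun g w => tsupport_fderiv_apply_subset ℝ w
  by_contra h'
  exact hx (h _ _ (h _ _ (subset_tsupport (fun x => fderiv ℝ (fun y => fderiv ℝ f y
    (EuclideanSpace.single i 1)) x (EuclideanSpace.single i 1)) h')))

theorem laplacian_sub {f g : 𝔼 → ℝ} (hf : ContDiff ℝ 2 f) (hg : ContDiff ℝ 2 g) (x : 𝔼) :
    laplacian (fun y => f y - g y) x = laplacian f x - laplacian g x := by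
  unfold laplacian
  rw [← Finset.sum_sub_distrib]
  refine Finset.sum_congr rfl fun i _ => ?_
  have h1 : (fun y => fderiv ℝ (fun y => f y - g y) y (EuclideanSpace.single i 1))
      = fun y => fderiv ℝ f y (EuclideanSpace.single i 1)
        - fderiv ℝ g y (EuclideanSpace.single i 1) := by
    funext y
    rw [fderiv_fun_sub (hf.differentiable (by norm_num) y) (hg.differentiable (by norm_num) y)]
    rfl
  rw [h1, fderiv_fun_sub]
  · rfl
  · exact (hf.fderiv_apply_const (l := 1) (by norm_num) _).differentiable (by norm_num) x
  · exact (hg.fderiv_apply_const (l := 1) (by norm_num) _).differentiable (by norm_num) x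

theorem integral_mul_fderiv_eq_neg_of_hasCompactSupport {f g : 𝔼 → ℝ} (hf : ContDiff ℝ 1 f)
    (hg : ContDiff ℝ 1 g) (hgc : HasCompactSupport g) (w : 𝔼) :
    ∫ x, f x * fderiv ℝ g x w = - ∫ x, fderiv ℝ f x w * g x := by
  have hf' := (hf.fderiv_apply_const (l := 0) (by norm_num) w).continuous
  have hg' := (hg.fderiv_apply_const (l := 0) (by norm_num) w).continuous
  refine integral_mul_fderiv_eq_neg_fderiv_mul_of_integrable ?_ ?_ ?_
    (fun x _ => hf.differentiable (by norm_num) x) (fun x _ => hg.differentiable (by norm_num) x)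
  · exact (hf'.mul hg.continuous).integrable_of_hasCompactSupport hgc.mul_left
  · exact (hf.continuous.mul hg').integrable_of_hasCompactSupport
      (hgc.fderiv_apply_const w).mul_left
  · exact (hf.continuous.mul hg.continuous).integrable_of_hasCompactSupport hgc.mul_left

/-- Kato's inequality for a smooth convex function, in a single direction. -/
theorem integral_deriv_comp_mul_fderiv_fderiv_le {j : ℝ → ℝ} (hj : ContDiff ℝ 2 j)
    (hj'' : ∀ s, 0 ≤ deriv (deriv j) s) {f φ : 𝔼 → ℝ} (hf : ContDiff ℝ 2 f)
    (hφ : ContDiff ℝ 2 φ) (hφc : HasCompactSupport φ) (hφ0 : ∀ x, 0 ≤ φ x) (w : 𝔼) :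
    ∫ x, deriv j (f x) * fderiv ℝ (fun y => fderiv ℝ f y w) x w * φ x
      ≤ ∫ x, j (f x) * fderiv ℝ (fun y => fderiv ℝ φ y w) x w := by
  have hj1 : ContDiff ℝ 1 (deriv j) := by
    have := (contDiff_succ_iff_deriv (n := 1) (f := j)).1 (by norm_num; exact hj)
    exact this.2.2
  have hf1 : ContDiff ℝ 1 f := hf.of_le (by norm_num)
  have hφ1 : ContDiff ℝ 1 φ := hφ.of_le (by norm_num)
  have hDf := hf.fderiv_apply_const (l := 1) (by norm_num) w
  have hDφ := hφ.fderiv_apply_const (l := 1) (by norm_num) w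
  have hDφc := hφc.fderiv_apply_const w
  have hjf : ContDiff ℝ 1 (fun x => j (f x)) := (hj.comp hf).of_le (by norm_num)
  have hg : ContDiff ℝ 1 (fun x => deriv j (f x) * φ x) := (hj1.comp hf1).mul hφ1
  have hgc : HasCompactSupport (fun x => deriv j (f x) * φ x) := hφc.mul_left
  have hfd : ∀ x, HasFDerivAt f (fderiv ℝ f x) x :=
    fun x => (hf1.differentiable (by norm_num) x).hasFDerivAt
  have hφd : ∀ x, HasFDerivAt φ (fderiv ℝ φ x) x :=
    fun x => (hφ1.differentiable (by norm_num) x).hasFDerivAt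
  have e1 : ∀ x, fderiv ℝ (fun x => deriv j (f x) * φ x) x w
      = deriv (deriv j) (f x) * fderiv ℝ f x w * φ x + deriv j (f x) * fderiv ℝ φ x w := by
    intro x
    have h1 : HasDerivAt (deriv j) (deriv (deriv j) (f x)) (f x) :=
      (hj1.differentiable (by norm_num) _).hasDerivAt
    have h2 := (h1.comp_hasFDerivAt x (hfd x)).fun_mul (hφd x)
    have h3 := h2.fderiv
    simp only [Function.comp_def] at h3
    rw [h3]
    simp
    ring
  have e2 : ∀ x, fderiv ℝ (fun x => j (f x)) x w = deriv j (f x) * fderiv ℝ f x w := by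
    intro x
    have h1 : HasDerivAt j (deriv j (f x)) (f x) :=
      (hj.differentiable (by norm_num) _).hasDerivAt
    have h3 := (h1.comp_hasFDerivAt x (hfd x)).fderiv
    simp only [Function.comp_def] at h3
    rw [h3]
    simp
  have i1 := integral_mul_fderiv_eq_neg_of_hasCompactSupport hDf hg hgc w
  have i2 := integral_mul_fderiv_eq_neg_of_hasCompactSupport hjf hDφ hDφc w
  have i3 : ∫ x, deriv j (f x) * fderiv ℝ (fun y => fderiv ℝ f y w) x w * φ x
      = ∫ x, fderiv ℝ (fun y => fderiv ℝ f y w) x w * (deriv j (f x) * φ x) := by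
    congr 1; funext x; ring
  rw [i2, i3, ← neg_eq_iff_eq_neg.2 i1]
  refine neg_le_neg (integral_mono ?_ ?_ fun x => ?_)
  · refine Continuous.integrable_of_hasCompactSupport ?_ hDφc.mul_left
    exact (hjf.fderiv_apply_const (l := 0) (by norm_num) w).continuous.mul hDφ.continuous
  · refine Continuous.integrable_of_hasCompactSupport ?_ (hgc.fderiv_apply_const w).mul_left
    exact hDf.continuous.mul (hg.fderiv_apply_const (l := 0) (by norm_num) w).continuous
  · dsimp only
    rw [e1, e2]
    have := mul_nonneg (mul_nonneg (hj'' (f x)) (sq_nonneg (fderiv ℝ f x w))) (hφ0 x)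
    nlinarith

/-- Kato's inequality for a smooth convex function. -/
theorem integral_deriv_comp_mul_laplacian_le {j : ℝ → ℝ} (hj : ContDiff ℝ 2 j)
    (hj'' : ∀ s, 0 ≤ deriv (deriv j) s) {f φ : 𝔼 → ℝ} (hf : ContDiff ℝ 2 f)
    (hφ : ContDiff ℝ 2 φ) (hφc : HasCompactSupport φ) (hφ0 : ∀ x, 0 ≤ φ x) :
    ∫ x, deriv j (f x) * laplacian f x * φ x ≤ ∫ x, j (f x) * laplacian φ x := by
  unfold laplacian
  simp only [Finset.mul_sum, Finset.sum_mul]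
  have hj1 : Continuous (deriv j) := hj.continuous_deriv (by norm_num)
  have hD : ∀ {g : 𝔼 → ℝ}, ContDiff ℝ 2 g → ∀ w,
      Continuous fun x => fderiv ℝ (fun y => fderiv ℝ g y w) x w := fun hg w =>
    ((hg.fderiv_apply_const (l := 1) (by norm_num) w).fderiv_apply_const
      (l := 0) (by norm_num) w).continuous
  rw [integral_finsetSum, integral_finsetSum]
  · exact Finset.sum_le_sum fun i _ =>
      integral_deriv_comp_mul_fderiv_fderiv_le hj hj'' hf hφ hφc hφ0 _
  · refine fun i _ => Continuous.integrable_of_hasCompactSupport ?_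
      ((hφc.fderiv_apply_const _).fderiv_apply_const _).mul_left
    exact (hj.continuous.comp hf.continuous).mul (hD hφ _)
  · refine fun i _ => Continuous.integrable_of_hasCompactSupport ?_ hφc.mul_left
    exact ((hj1.comp hf.continuous).mul (hD hf _)).mul hφ.continuous

end Laplacian

section AbsApprox

theorem hasDerivAt_sqrt_sq_add {ε : ℝ} (hε : 0 < ε) (s : ℝ) :
    HasDerivAt (fun s => √(s ^ 2 + ε)) (s / √(s ^ 2 + ε)) s := by
  have h : 0 < s ^ 2 + ε := by positivity
  have h1 : HasDerivAt (fun s => s ^ 2 + ε) (2 * s) s := by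
    simpa using (hasDerivAt_pow 2 s).add_const ε
  convert h1.sqrt h.ne' using 1
  field_simp

theorem contDiff_sqrt_sq_add {ε : ℝ} (hε : 0 < ε) : ContDiff ℝ 2 (fun s => √(s ^ 2 + ε)) :=
  ContDiff.sqrt (by fun_prop) fun s => by positivity

theorem deriv_sqrt_sq_add {ε : ℝ} (hε : 0 < ε) :
    deriv (fun s => √(s ^ 2 + ε)) = fun s => s / √(s ^ 2 + ε) :=
  funext fun s => (hasDerivAt_sqrt_sq_add hε s).deriv

theorem deriv_deriv_sqrt_sq_add_nonneg {ε : ℝ} (hε : 0 < ε) (s : ℝ) :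
    0 ≤ deriv (deriv (fun s => √(s ^ 2 + ε))) s := by
  have h : 0 < s ^ 2 + ε := by positivity
  have h' : √(s ^ 2 + ε) ≠ 0 := (Real.sqrt_pos.2 h).ne'
  rw [deriv_sqrt_sq_add hε, ((hasDerivAt_id' s).fun_div (hasDerivAt_sqrt_sq_add hε s) h').deriv]
  refine div_nonneg ?_ (sq_nonneg _)
  rw [one_mul]
  rw [← mul_div_assoc, sub_nonneg, div_le_iff₀ (Real.sqrt_pos.2 h), Real.mul_self_sqrt h.le]
  nlinarith

theorem abs_div_sqrt_sq_add_le_one {ε : ℝ} (hε : 0 < ε) (s : ℝ) : |s / √(s ^ 2 + ε)| ≤ 1 := by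
  rw [abs_div, abs_of_nonneg (Real.sqrt_nonneg _)]
  refine div_le_one_of_le₀ (Real.abs_le_sqrt (by linarith)) (Real.sqrt_nonneg _)

theorem tendsto_sqrt_sq_add (s : ℝ) :
    Tendsto (fun ε => √(s ^ 2 + ε)) (𝓝[>] 0) (𝓝 |s|) := by
  have h : Continuous fun ε : ℝ => √(s ^ 2 + ε) := by fun_prop
  have := h.tendsto 0
  rw [add_zero, Real.sqrt_sq_eq_abs] at this
  exact this.mono_left nhdsWithin_le_nhds

theorem tendsto_div_sqrt_sq_add (s : ℝ) :
    Tendsto (fun ε => s / √(s ^ 2 + ε)) (𝓝[>] 0) (𝓝 (Real.sign s)) := by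
  rcases eq_or_ne s 0 with rfl | hs
  · simp
  · have := (tendsto_const_nhds (x := s)).div (tendsto_sqrt_sq_add s) (abs_ne_zero.2 hs)
    rcases lt_or_gt_of_ne hs with h | h
    · rw [abs_of_neg h, div_neg, div_self hs] at this
      rwa [Real.sign_of_neg h]
    · rw [abs_of_pos h, div_self hs] at this
      rwa [Real.sign_of_pos h]

theorem sqrt_sq_add_le {ε : ℝ} (hε1 : ε ≤ 1) (s : ℝ) : √(s ^ 2 + ε) ≤ |s| + 1 := by
  rw [Real.sqrt_le_left (by positivity)]
  nlinarith [sq_abs s, abs_nonneg s]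

theorem abs_real_sign_le_one (s : ℝ) : |Real.sign s| ≤ 1 := by
  rcases Real.sign_apply_eq s with h | h | h <;> simp [h]

theorem measurable_real_sign : Measurable Real.sign := by
  unfold Real.sign
  exact Measurable.ite measurableSet_Iio measurable_const
    (Measurable.ite measurableSet_Ioi measurable_const measurable_const)

/-- The fundamental theorem of calculus for `|d|`. -/
theorem integral_sign_mul_deriv_eq_abs_sub_abs {d d' : ℝ → ℝ} {s t : ℝ} (hst : s ≤ t)
    (hd : ∀ τ ∈ Set.Icc s t, HasDerivAt d (d' τ) τ) (hd' : ContinuousOn d' (Set.Icc s t)) :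
    ∫ τ in s..t, Real.sign (d τ) * d' τ = |d t| - |d s| := by
  have hdc : ContinuousOn d (Set.Icc s t) := fun τ hτ => (hd τ hτ).continuousAt.continuousWithinAt
  have hpos : ∀ᶠ ε : ℝ in 𝓝[>] 0, 0 < ε := self_mem_nhdsWithin
  have key : ∀ ε : ℝ, 0 < ε → ContinuousOn (fun τ => d τ / √(d τ ^ 2 + ε) * d' τ) (Set.Icc s t) :=
    fun ε hε => (hdc.div ((hdc.pow 2).add continuousOn_const).sqrt
      fun τ _ => (Real.sqrt_pos.2 (add_pos_of_nonneg_of_pos (sq_nonneg _) hε)).ne').mul hd'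
  have h1 : Tendsto (fun ε => ∫ τ in s..t, d τ / √(d τ ^ 2 + ε) * d' τ) (𝓝[>] 0)
      (𝓝 (∫ τ in s..t, Real.sign (d τ) * d' τ)) := by
    refine intervalIntegral.tendsto_integral_filter_of_dominated_convergence (fun τ => |d' τ|)
      ?_ ?_ ?_ ?_
    · filter_upwards [hpos] with ε hε
      rw [Set.uIoc_of_le hst]
      exact ((key ε hε).mono Set.Ioc_subset_Icc_self).aestronglyMeasurable measurableSet_Ioc
    · filter_upwards [hpos] with ε hε
      refine Eventually.of_forall fun τ _ => ?_
      rw [norm_mul, Real.norm_eq_abs, Real.norm_eq_abs]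
      exact mul_le_of_le_one_left (abs_nonneg _) (abs_div_sqrt_sq_add_le_one hε _)
    · refine ContinuousOn.intervalIntegrable ?_
      rw [Set.uIcc_of_le hst]
      exact hd'.abs
    · exact Eventually.of_forall fun τ _ => (tendsto_div_sqrt_sq_add (d τ)).mul_const _
  have h2 : Tendsto (fun ε => √(d t ^ 2 + ε) - √(d s ^ 2 + ε)) (𝓝[>] 0) (𝓝 (|d t| - |d s|)) :=
    (tendsto_sqrt_sq_add _).sub (tendsto_sqrt_sq_add _)
  refine tendsto_nhds_unique (h1.congr' ?_) h2
  filter_upwards [hpos] with ε hε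
  refine intervalIntegral.integral_eq_sub_of_hasDerivAt (f := fun τ => √(d τ ^ 2 + ε)) ?_ ?_
  · intro τ hτ
    rw [Set.uIcc_of_le hst] at hτ
    exact (hasDerivAt_sqrt_sq_add hε (d τ)).comp τ (hd τ hτ)
  · refine ContinuousOn.intervalIntegrable ?_
    rw [Set.uIcc_of_le hst]
    exact key ε hε

/-- Kato's inequality `sign f * Δ f ≤ Δ |f|`, tested against a nonnegative function. -/
theorem integral_sign_mul_laplacian_le {n : ℕ} {f φ : EuclideanSpace ℝ (Fin n) → ℝ}
    (hf : ContDiff ℝ 2 f) (hφ : ContDiff ℝ 2 φ) (hφc : HasCompactSupport φ)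
    (hφ0 : ∀ x, 0 ≤ φ x) :
    ∫ x, Real.sign (f x) * laplacian f x * φ x ≤ ∫ x, |f x| * laplacian φ x := by
  have hpos : ∀ᶠ ε : ℝ in 𝓝[>] 0, 0 < ε := self_mem_nhdsWithin
  have hle : ∀ᶠ ε : ℝ in 𝓝[>] 0, ε ≤ 1 :=
    mem_nhdsWithin_of_mem_nhds (Iic_mem_nhds zero_lt_one)
  have hφL : HasCompactSupport (laplacian φ) :=
    HasCompactSupport.intro hφc fun x hx => HasCompactSupport.laplacian_eq_zero hx
  have hfc := hf.continuous
  have hsq : ∀ ε : ℝ, Continuous fun x => √(f x ^ 2 + ε) := fun ε => by fun_prop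
  have h1 : Tendsto (fun ε => ∫ x, f x / √(f x ^ 2 + ε) * laplacian f x * φ x) (𝓝[>] 0)
      (𝓝 (∫ x, Real.sign (f x) * laplacian f x * φ x)) := by
    refine tendsto_integral_filter_of_dominated_convergence (fun x => |laplacian f x * φ x|)
      ?_ ?_ ?_ ?_
    · filter_upwards [hpos] with ε hε
      refine Continuous.aestronglyMeasurable ?_
      exact ((hfc.div (hsq ε) fun x => (Real.sqrt_pos.2 (by positivity)).ne').mul
        hf.continuous_laplacian).mul hφ.continuous
    · filter_upwards [hpos] with ε hε
      refine Eventually.of_forall fun x => ?_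
      rw [mul_assoc, norm_mul, Real.norm_eq_abs, Real.norm_eq_abs]
      exact mul_le_of_le_one_left (abs_nonneg _) (abs_div_sqrt_sq_add_le_one hε _)
    · exact ((hf.continuous_laplacian.mul hφ.continuous).integrable_of_hasCompactSupport
        hφc.mul_left).abs
    · exact Eventually.of_forall fun x =>
        ((tendsto_div_sqrt_sq_add (f x)).mul_const _).mul_const _
  have h2 : Tendsto (fun ε => ∫ x, √(f x ^ 2 + ε) * laplacian φ x) (𝓝[>] 0)
      (𝓝 (∫ x, |f x| * laplacian φ x)) := by
    refine tendsto_integral_filter_of_dominated_convergence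
      (fun x => (|f x| + 1) * |laplacian φ x|) ?_ ?_ ?_ ?_
    · exact Eventually.of_forall fun ε =>
        ((hsq ε).mul hφ.continuous_laplacian).aestronglyMeasurable
    · filter_upwards [hle] with ε hε
      refine Eventually.of_forall fun x => ?_
      rw [norm_mul, Real.norm_eq_abs, Real.norm_eq_abs, abs_of_nonneg (Real.sqrt_nonneg _)]
      exact mul_le_mul_of_nonneg_right (sqrt_sq_add_le hε _) (abs_nonneg _)
    · refine Continuous.integrable_of_hasCompactSupport ?_ (HasCompactSupport.mul_left ?_)
      · exact (hfc.abs.add continuous_const).mul hφ.continuous_laplacian.abs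
      · exact hφL.comp_left abs_zero
    · exact Eventually.of_forall fun x => (tendsto_sqrt_sq_add (f x)).mul_const _
  refine le_of_tendsto_of_tendsto h1 h2 ?_
  filter_upwards [hpos] with ε hε
  have := integral_deriv_comp_mul_laplacian_le (contDiff_sqrt_sq_add hε)
    (deriv_deriv_sqrt_sq_add_nonneg hε) hf hφ hφc hφ0
  simpa only [deriv_sqrt_sq_add hε] using this

end AbsApprox

section TruncatedParaboloid

theorem hasDerivAt_max_zero_pow {k : ℕ} (hk : 1 ≤ k) (y : ℝ) :
    HasDerivAt (fun y : ℝ => max y 0 ^ (k + 1)) ((k + 1 : ℝ) * max y 0 ^ k) y := by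
  rcases lt_trichotomy y 0 with hy | rfl | hy
  · rw [max_eq_right hy.le, zero_pow (by omega), mul_zero]
    refine (hasDerivAt_const y (0 : ℝ)).congr_of_eventuallyEq ?_
    filter_upwards [Iio_mem_nhds hy] with z hz
    rw [max_eq_right (le_of_lt hz), zero_pow (by omega)]
  · rw [max_self, zero_pow (by omega), mul_zero]
    refine HasDerivAt.of_isLittleO ?_
    simp only [sub_zero, smul_zero, max_self, ne_eq, Nat.add_eq_zero_iff, one_ne_zero, and_false,
      not_false_eq_true, zero_pow]
    have h1 : (fun y : ℝ => max y 0 ^ (k + 1)) =O[𝓝 0] fun y => y ^ (k + 1) := by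
      refine Asymptotics.IsBigO.of_bound 1 (Eventually.of_forall fun z => ?_)
      rw [one_mul, norm_pow, norm_pow]
      refine pow_le_pow_left₀ (norm_nonneg _) ?_ _
      rw [Real.norm_eq_abs, Real.norm_eq_abs, abs_of_nonneg (le_max_right _ _)]
      exact max_le (le_abs_self _) (abs_nonneg _)
    refine h1.trans_isLittleO ?_
    have := Asymptotics.isLittleO_pow_pow (𝕜 := ℝ) (m := 1) (n := k + 1) (by omega)
    simpa using this
  · rw [max_eq_left hy.le]
    have h : HasDerivAt (fun y : ℝ => y ^ (k + 1)) ((k + 1 : ℝ) * y ^ k) y := by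
      simpa using hasDerivAt_pow (k + 1) y
    refine h.congr_of_eventuallyEq ?_
    filter_upwards [Ioi_mem_nhds hy] with z hz
    rw [max_eq_left (le_of_lt hz)]

theorem contDiff_max_zero_pow {k : ℕ} (hk : 1 ≤ k) :
    ContDiff ℝ 2 (fun y : ℝ => max y 0 ^ (k + 2)) := by
  have hc : ∀ k : ℕ, Continuous (fun y : ℝ => max y 0 ^ k) := fun k => by fun_prop
  have d1 : ∀ l : ℕ, 1 ≤ l → deriv (fun y : ℝ => max y 0 ^ (l + 1))
      = fun y => (l + 1 : ℝ) * max y 0 ^ l := fun l hl =>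
    funext fun y => (hasDerivAt_max_zero_pow hl y).deriv
  have c1 : ∀ l : ℕ, 1 ≤ l → ContDiff ℝ 1 (fun y : ℝ => max y 0 ^ (l + 1)) := by
    intro l hl
    refine contDiff_one_iff_deriv.2
      ⟨fun y => (hasDerivAt_max_zero_pow hl y).differentiableAt, ?_⟩
    rw [d1 l hl]
    exact continuous_const.mul (hc l)
  have h2 : (2 : WithTop ℕ∞) = 1 + 1 := by norm_num
  rw [h2, contDiff_succ_iff_deriv]
  refine ⟨fun y => (hasDerivAt_max_zero_pow (by omega) y).differentiableAt, by simp, ?_⟩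
  rw [d1 (k + 1) (by omega)]
  exact contDiff_const.mul (c1 k hk)

/-- A power of the paraboloid `1 - ‖x‖² / ρ²`, truncated at zero. -/
noncomputable def truncParaboloid {n : ℕ} (j : ℕ) (ρ : ℝ) (x : EuclideanSpace ℝ (Fin n)) : ℝ :=
  max (1 - ‖x‖ ^ 2 / ρ ^ 2) 0 ^ j

variable {n j : ℕ} {ρ : ℝ}

local notation "𝔼" => EuclideanSpace ℝ (Fin n)

theorem truncParaboloid_nonneg (x : 𝔼) : 0 ≤ truncParaboloid j ρ x :=
  pow_nonneg (le_max_right _ _) _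

theorem max_one_sub_le_one (x : 𝔼) : max (1 - ‖x‖ ^ 2 / ρ ^ 2) 0 ≤ 1 :=
  max_le (by linarith [div_nonneg (sq_nonneg ‖x‖) (sq_nonneg ρ)]) zero_le_one

theorem truncParaboloid_le_one (x : 𝔼) : truncParaboloid j ρ x ≤ 1 :=
  pow_le_one₀ (le_max_right _ _) (max_one_sub_le_one x)

theorem truncParaboloid_succ_le (x : 𝔼) :
    truncParaboloid (j + 1) ρ x ≤ truncParaboloid j ρ x :=
  pow_le_pow_of_le_one (le_max_right _ _) (max_one_sub_le_one x) (Nat.le_succ j)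

theorem truncParaboloid_pos (hρ : 0 < ρ) {x : 𝔼} (hx : ‖x‖ < ρ) : 0 < truncParaboloid j ρ x := by
  refine pow_pos (lt_max_of_lt_left ?_) _
  rw [sub_pos, div_lt_one (by positivity)]
  exact pow_lt_pow_left₀ hx (norm_nonneg _) two_ne_zero

theorem truncParaboloid_eq_zero (hj : 1 ≤ j) (hρ : 0 < ρ) {x : 𝔼} (hx : ρ ≤ ‖x‖) :
    truncParaboloid j ρ x = 0 := by
  unfold truncParaboloid
  rw [max_eq_right, zero_pow (by omega)]
  rw [sub_nonpos, one_le_div (by positivity)]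
  exact pow_le_pow_left₀ hρ.le hx 2

theorem truncParaboloid_mono {r : ℝ} (hr : 0 < r) (hrρ : r ≤ ρ) (x : 𝔼) :
    truncParaboloid j r x ≤ truncParaboloid j ρ x := by
  refine pow_le_pow_left₀ (le_max_right _ _) (max_le_max_right _ (sub_le_sub_left ?_ _)) _
  gcongr

theorem continuous_truncParaboloid : Continuous (truncParaboloid j ρ : 𝔼 → ℝ) := by
  unfold truncParaboloid
  fun_prop

theorem hasCompactSupport_truncParaboloid (hj : 1 ≤ j) (hρ : 0 < ρ) :
    HasCompactSupport (truncParaboloid j ρ : 𝔼 → ℝ) :=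
  HasCompactSupport.intro (isCompact_closedBall 0 ρ) fun x hx =>
    truncParaboloid_eq_zero hj hρ (by simpa using (not_le.1 fun h => hx (by simpa using h)).le)

theorem contDiff_truncParaboloid (hj : 1 ≤ j) :
    ContDiff ℝ 2 (truncParaboloid (j + 2) ρ : 𝔼 → ℝ) :=
  (contDiff_max_zero_pow hj).comp
    (contDiff_const.sub ((contDiff_norm_sq ℝ).div_const _))

theorem fderiv_truncParaboloid_single (hj : 1 ≤ j) (x : 𝔼) (i : Fin n) :
    fderiv ℝ (truncParaboloid (j + 1) ρ) x (EuclideanSpace.single i 1)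
      = -(2 * (j + 1) / ρ ^ 2) * (x i * truncParaboloid j ρ x) := by
  have h1 : HasFDerivAt (fun x : 𝔼 => 1 - ‖x‖ ^ 2 / ρ ^ 2)
      (-((ρ ^ 2)⁻¹ • (2 • innerSL ℝ x))) x := by
    have := (((hasStrictFDerivAt_norm_sq x).hasFDerivAt).mul_const ((ρ ^ 2)⁻¹)).const_sub 1
    simpa only [div_eq_mul_inv] using this
  have h2 := (hasDerivAt_max_zero_pow hj (1 - ‖x‖ ^ 2 / ρ ^ 2)).comp_hasFDerivAt x h1
  have h3 : HasFDerivAt (truncParaboloid (j + 1) ρ : 𝔼 → ℝ) _ x := h2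
  rw [h3.fderiv]
  simp [truncParaboloid, EuclideanSpace.inner_single_right]
  ring

theorem laplacian_truncParaboloid (hj : 1 ≤ j) (x : 𝔼) :
    laplacian (truncParaboloid (j + 2) ρ) x
      = 4 * (j + 2) * (j + 1) * ‖x‖ ^ 2 / ρ ^ 4 * truncParaboloid j ρ x
        - 2 * (j + 2) * n / ρ ^ 2 * truncParaboloid (j + 1) ρ x := by
  unfold laplacian
  have h1 : ∀ i : Fin n, (fun y : 𝔼 => fderiv ℝ (truncParaboloid (j + 2) ρ) y
      (EuclideanSpace.single i 1))
      = fun y => -(2 * (j + 2) / ρ ^ 2) * (y i * truncParaboloid (j + 1) ρ y) := by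
    intro i
    funext y
    rw [fderiv_truncParaboloid_single (by omega)]
    push_cast
    ring
  have h2 : ∀ i : Fin n, fderiv ℝ (fun y : 𝔼 => -(2 * (j + 2) / ρ ^ 2) *
        (y i * truncParaboloid (j + 1) ρ y)) x (EuclideanSpace.single i 1)
      = 4 * (j + 2) * (j + 1) / ρ ^ 4 * truncParaboloid j ρ x * x i ^ 2
        - 2 * (j + 2) / ρ ^ 2 * truncParaboloid (j + 1) ρ x := by
    intro i
    have d1 : HasFDerivAt (fun y : 𝔼 => y i) (EuclideanSpace.proj i : 𝔼 →L[ℝ] ℝ) x :=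
      (EuclideanSpace.proj i : 𝔼 →L[ℝ] ℝ).hasFDerivAt
    have d2 : DifferentiableAt ℝ (truncParaboloid (j + 1) ρ : 𝔼 → ℝ) x := by
      have e1 : DifferentiableAt ℝ (fun x : 𝔼 => 1 - ‖x‖ ^ 2 / ρ ^ 2) x :=
        ((((contDiff_norm_sq ℝ (E := 𝔼) (n := 1)).differentiable (by norm_num) x)).mul_const
          (ρ ^ 2)⁻¹).const_sub 1
      exact (hasDerivAt_max_zero_pow hj (1 - ‖x‖ ^ 2 / ρ ^ 2)).differentiableAt.comp x e1
    have d3 := (d1.fun_mul d2.hasFDerivAt).const_mul (-(2 * (j + 2) / ρ ^ 2))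
    rw [d3.fderiv]
    simp only [FunLike.coe_smul, FunLike.coe_add, Pi.smul_apply,
      Pi.add_apply, smul_eq_mul, fderiv_truncParaboloid_single hj]
    simp
    ring
  simp only [h1, h2]
  rw [Finset.sum_sub_distrib, ← Finset.mul_sum, EuclideanSpace.real_norm_sq_eq]
  simp
  ring

theorem abs_laplacian_truncParaboloid_le (hj : 1 ≤ j) (hρ : 0 < ρ) (x : 𝔼) :
    |laplacian (truncParaboloid (j + 2) ρ) x|
      ≤ (4 * (j + 2) * (j + 1) + 2 * (j + 2) * n) / ρ ^ 2 * truncParaboloid j ρ x := by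
  rcases le_or_gt ρ ‖x‖ with hx | hx
  · rw [laplacian_truncParaboloid hj, truncParaboloid_eq_zero hj hρ hx,
      truncParaboloid_eq_zero (by omega) hρ hx]
    simp
  have hx2 : ‖x‖ ^ 2 ≤ ρ ^ 2 := pow_le_pow_left₀ (norm_nonneg _) hx.le 2
  have h0 := truncParaboloid_nonneg (j := j) (ρ := ρ) x
  have h1 := truncParaboloid_nonneg (j := j + 1) (ρ := ρ) x
  have h2 := truncParaboloid_succ_le (j := j) (ρ := ρ) x
  rw [laplacian_truncParaboloid hj]
  have e1 : 4 * (j + 2) * (j + 1) * ‖x‖ ^ 2 / ρ ^ 4 * truncParaboloid j ρ x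
      ≤ 4 * (j + 2) * (j + 1) / ρ ^ 2 * truncParaboloid j ρ x := by
    refine mul_le_mul_of_nonneg_right ?_ h0
    rw [div_le_div_iff₀ (by positivity) (by positivity)]
    have : (4 * (j + 2) * (j + 1) * ρ ^ 2 : ℝ) * ‖x‖ ^ 2
      ≤ (4 * (j + 2) * (j + 1) * ρ ^ 2 : ℝ) * ρ ^ 2 := by gcongr
    nlinarith
  have e2 : 2 * (j + 2) * n / ρ ^ 2 * truncParaboloid (j + 1) ρ x
      ≤ 2 * (j + 2) * n / ρ ^ 2 * truncParaboloid j ρ x := by gcongr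
  have e3 : 0 ≤ 4 * (j + 2) * (j + 1) * ‖x‖ ^ 2 / ρ ^ 4 * truncParaboloid j ρ x := by positivity
  have e4 : 0 ≤ 2 * (j + 2) * n / ρ ^ 2 * truncParaboloid (j + 1) ρ x := by positivity
  rw [add_div, add_mul]
  exact abs_le.2 ⟨by linarith, by linarith⟩

theorem hasDerivAt_truncParaboloid_radius (hj : 1 ≤ j) (hρ : 0 < ρ) (x : 𝔼) :
    HasDerivAt (fun r => truncParaboloid (j + 1) r x)
      (2 * (j + 1) * ‖x‖ ^ 2 / ρ ^ 3 * truncParaboloid j ρ x) ρ := by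
  have h1 : HasDerivAt (fun r : ℝ => 1 - ‖x‖ ^ 2 / r ^ 2) (2 * ‖x‖ ^ 2 / ρ ^ 3) ρ := by
    have := ((hasDerivAt_const ρ (‖x‖ ^ 2)).fun_div (hasDerivAt_pow 2 ρ)
      (by positivity)).const_sub 1
    refine this.congr_deriv ?_
    field_simp
    simp
    ring
  have h2 := (hasDerivAt_max_zero_pow hj (1 - ‖x‖ ^ 2 / ρ ^ 2)).comp ρ h1
  refine h2.congr_deriv ?_
  unfold truncParaboloid
  ring

end TruncatedParaboloid

section SpaceTime

variable {n : ℕ}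

local notation "𝔼" => EuclideanSpace ℝ (Fin n)

theorem integrable_prod_restrict_of_continuousOn {G : 𝔼 × ℝ → ℝ} {φ : 𝔼 → ℝ} {s t : ℝ}
    (hs : 0 < s) (hG : ContinuousOn G (Set.univ ×ˢ Set.Ioi 0)) (hφ : Continuous φ)
    (hφc : HasCompactSupport φ) :
    Integrable (fun q : 𝔼 × ℝ => G q * φ q.1)
      ((volume : Measure 𝔼).prod (volume.restrict (Set.Ioc s t))) := by
  have h1 : (volume : Measure 𝔼).prod (volume.restrict (Set.Ioc s t))
      = (volume.prod volume).restrict (Set.univ ×ˢ Set.Ioc s t) := by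
    rw [← Measure.prod_restrict, Measure.restrict_univ]
  rw [h1]
  have h2 : IntegrableOn (fun q : 𝔼 × ℝ => G q * φ q.1) (tsupport φ ×ˢ Set.Icc s t)
      (volume.prod volume) := by
    refine ContinuousOn.integrableOn_compact (hφc.isCompact.prod isCompact_Icc) ?_
    refine (hG.mono ?_).mul (hφ.comp continuous_fst).continuousOn
    exact Set.prod_mono (Set.subset_univ _) fun τ hτ => lt_of_lt_of_le hs hτ.1
  have h3 : IntegrableOn (fun q : 𝔼 × ℝ => G q * φ q.1) (Set.univ ×ˢ Set.Icc s t)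
      (volume.prod volume) := by
    refine h2.of_forall_sdiff_eq_zero (MeasurableSet.univ.prod measurableSet_Icc) ?_
    rintro ⟨x, τ⟩ ⟨hx1, hx2⟩
    have : x ∉ tsupport φ := fun h => hx2 ⟨h, hx1.2⟩
    simp [image_eq_zero_of_notMem_tsupport this]
  exact h3.mono_set (Set.prod_mono le_rfl Set.Ioc_subset_Icc_self)

theorem intervalIntegral_integral_swap {F : 𝔼 → ℝ → ℝ} {s t : ℝ} (hst : s ≤ t)
    (hF : Integrable (fun q : 𝔼 × ℝ => F q.1 q.2)
      ((volume : Measure 𝔼).prod (volume.restrict (Set.Ioc s t)))) :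
    ∫ τ in s..t, ∫ x, F x τ = ∫ x, ∫ τ in s..t, F x τ := by
  simp only [intervalIntegral.integral_of_le hst]
  exact (integral_integral_swap hF).symm

/-- The properties of the difference `d = u - v` of two solutions of the fast diffusion equation,
together with `e = u ^ m - v ^ m`, that enter the uniqueness proof. -/
structure IsFastDiffusionDifference (m : ℝ) (d e : 𝔼 → ℝ → ℝ) : Prop where
  continuousOn_left : ContinuousOn (fun q : 𝔼 × ℝ => d q.1 q.2) (Set.univ ×ˢ Set.Ioi 0)
  continuousOn_right : ContinuousOn (fun q : 𝔼 × ℝ => e q.1 q.2) (Set.univ ×ˢ Set.Ioi 0)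
  contDiff : ∀ t > 0, ContDiff ℝ 2 fun x => e x t
  hasDerivAt : ∀ x, ∀ t > 0, HasDerivAt (d x) (laplacian (fun y => e y t) x) t
  continuousOn_laplacian : ContinuousOn (fun q : 𝔼 × ℝ => laplacian (fun y => e y q.2) q.1)
    (Set.univ ×ˢ Set.Ioi 0)
  sign_eq : ∀ x, ∀ t > 0, Real.sign (e x t) = Real.sign (d x t)
  abs_le : ∀ x, ∀ t > 0, |e x t| ≤ |d x t| ^ m

namespace IsFastDiffusionDifference

variable {m : ℝ} {d e : EuclideanSpace ℝ (Fin n) → ℝ → ℝ}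

theorem continuous_left (h : IsFastDiffusionDifference m d e) {t : ℝ} (ht : 0 < t) :
    Continuous fun x => d x t :=
  h.continuousOn_left.comp_continuous (continuous_id.prodMk continuous_const)
    fun _ => ⟨Set.mem_univ _, ht⟩

theorem continuous_right (h : IsFastDiffusionDifference m d e) {t : ℝ} (ht : 0 < t) :
    Continuous fun x => e x t :=
  h.continuousOn_right.comp_continuous (continuous_id.prodMk continuous_const)
    fun _ => ⟨Set.mem_univ _, ht⟩

theorem continuousOn_right_time (h : IsFastDiffusionDifference m d e) (x : 𝔼) :
    ContinuousOn (e x) (Set.Ioi 0) :=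
  h.continuousOn_right.comp (continuous_const.prodMk continuous_id).continuousOn
    fun _ hτ => ⟨Set.mem_univ x, hτ⟩

theorem integrable_abs_mul (h : IsFastDiffusionDifference m d e) {t : ℝ} (ht : 0 < t) {φ : 𝔼 → ℝ}
    (hφ : Continuous φ) (hφc : HasCompactSupport φ) : Integrable fun x => |d x t| * φ x :=
  ((h.continuous_left ht).abs.mul hφ).integrable_of_hasCompactSupport hφc.mul_left

/-- The time-integrated Kato inequality `∂ₜ |d| ≤ Δ |e|`, tested against a nonnegative
function. -/
theorem integral_abs_sub_integral_abs_le (h : IsFastDiffusionDifference m d e) {s t : ℝ}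
    (hs : 0 < s) (hst : s ≤ t) {φ : 𝔼 → ℝ} (hφ : ContDiff ℝ 2 φ) (hφc : HasCompactSupport φ)
    (hφ0 : ∀ x, 0 ≤ φ x) :
    (∫ x, |d x t| * φ x) - ∫ x, |d x s| * φ x
      ≤ ∫ τ in s..t, ∫ x, |e x τ| * laplacian φ x := by
  have hφL : HasCompactSupport (laplacian φ) :=
    HasCompactSupport.intro hφc fun x hx => HasCompactSupport.laplacian_eq_zero hx
  have i1 : Integrable (fun q : 𝔼 × ℝ => |e q.1 q.2| * laplacian φ q.1)
      ((volume : Measure 𝔼).prod (volume.restrict (Set.Ioc s t))) :=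
    integrable_prod_restrict_of_continuousOn hs h.continuousOn_right.abs hφ.continuous_laplacian hφL
  have i2 : Integrable (fun q : 𝔼 × ℝ =>
      Real.sign (d q.1 q.2) * (laplacian (fun y => e y q.2) q.1 * φ q.1))
      ((volume : Measure 𝔼).prod (volume.restrict (Set.Ioc s t))) := by
    refine (integrable_prod_restrict_of_continuousOn hs h.continuousOn_laplacian hφ.continuous
      hφc).bdd_mul (c := 1) ?_ (Eventually.of_forall fun q => abs_real_sign_le_one _)
    have h1 : (volume : Measure 𝔼).prod (volume.restrict (Set.Ioc s t))
        = (volume.prod volume).restrict (Set.univ ×ˢ Set.Ioc s t) := by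
      rw [← Measure.prod_restrict, Measure.restrict_univ]
    rw [h1]
    have h2 : ContinuousOn (fun q : 𝔼 × ℝ => d q.1 q.2) (Set.univ ×ˢ Set.Ioc s t) :=
      h.continuousOn_left.mono (Set.prod_mono le_rfl fun τ hτ => hs.trans hτ.1)
    exact (measurable_real_sign.comp_aemeasurable
      (h2.aemeasurable (MeasurableSet.univ.prod measurableSet_Ioc))).aestronglyMeasurable
  have e1 : (∫ x, |d x t| * φ x) - ∫ x, |d x s| * φ x
      = ∫ x, ∫ τ in s..t, Real.sign (d x τ) * (laplacian (fun y => e y τ) x * φ x) := by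
    rw [← integral_sub (h.integrable_abs_mul (hs.trans_le hst) hφ.continuous hφc)
      (h.integrable_abs_mul hs hφ.continuous hφc)]
    refine integral_congr_ae (Eventually.of_forall fun x => ?_)
    have hpair : Continuous fun τ : ℝ => (x, τ) := continuous_const.prodMk continuous_id
    have hmaps : Set.MapsTo (fun τ : ℝ => (x, τ)) (Set.Icc s t) (Set.univ ×ˢ Set.Ioi 0) :=
      fun τ hτ => ⟨Set.mem_univ _, hs.trans_le hτ.1⟩
    have hcont : ContinuousOn (fun τ => laplacian (fun y => e y τ) x) (Set.Icc s t) := by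
      have := h.continuousOn_laplacian.comp hpair.continuousOn hmaps
      exact this
    have := integral_sign_mul_deriv_eq_abs_sub_abs hst
      (fun τ hτ => h.hasDerivAt x τ (hs.trans_le hτ.1)) hcont
    simp only [← mul_assoc]
    rw [intervalIntegral.integral_mul_const, this]
    ring
  rw [e1, ← intervalIntegral_integral_swap hst i2]
  refine intervalIntegral.integral_mono_on hst ?_ ?_ fun τ hτ => ?_
  · rw [intervalIntegrable_iff_integrableOn_Ioc_of_le hst]
    exact i2.integral_prod_right
  · rw [intervalIntegrable_iff_integrableOn_Ioc_of_le hst]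
    exact i1.integral_prod_right
  · have hτ0 : 0 < τ := hs.trans_le hτ.1
    have := integral_sign_mul_laplacian_le (h.contDiff τ hτ0) hφ hφc hφ0
    simpa only [h.sign_eq _ τ hτ0, mul_assoc] using this

theorem continuous_integral_abs (h : IsFastDiffusionDifference m d e) {s t : ℝ} (hs : 0 < s)
    (hst : s ≤ t) : Continuous fun x => ∫ τ in s..t, |e x τ| := by
  have h1 : Continuous (Function.uncurry fun (x : 𝔼) (τ : ℝ) => |e x (max τ s)|) := by
    refine (h.continuousOn_right.comp_continuous
      (continuous_fst.prodMk (continuous_snd.max continuous_const)) fun q => ?_).abs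
    exact ⟨Set.mem_univ _, lt_max_of_lt_right hs⟩
  convert intervalIntegral.continuous_parametric_intervalIntegral_of_continuous' (μ := volume)
    h1 s t using 2 with x
  refine intervalIntegral.integral_congr fun τ hτ => ?_
  rw [Set.uIcc_of_le hst] at hτ
  simp only [max_eq_left hτ.1]

/-- The swapped form of a space-time integral of `|e|`. -/
theorem integral_integral_abs_mul_eq (h : IsFastDiffusionDifference m d e) {s t : ℝ} (hs : 0 < s)
    (hst : s ≤ t) {ψ : 𝔼 → ℝ} (hψ : Continuous ψ) (hψc : HasCompactSupport ψ) :
    ∫ τ in s..t, ∫ x, |e x τ| * ψ x = ∫ x, (∫ τ in s..t, |e x τ|) * ψ x := by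
  rw [intervalIntegral_integral_swap hst
    (integrable_prod_restrict_of_continuousOn hs h.continuousOn_right.abs hψ hψc)]
  simp only [intervalIntegral.integral_mul_const]

end IsFastDiffusionDifference

end SpaceTime

section Uniqueness

theorem Real.rpow_le_rpow_add_rpow_sub_one_mul {a δ m : ℝ} (ha : 0 ≤ a) (hδ : 0 < δ) (hm0 : 0 ≤ m)
    (hm1 : m ≤ 1) : a ^ m ≤ δ ^ m + δ ^ (m - 1) * a := by
  rcases le_total a δ with h | h
  · have : 0 ≤ δ ^ (m - 1) * a := by positivity
    linarith [Real.rpow_le_rpow ha h hm0]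
  · have ha' : 0 < a := hδ.trans_le h
    have h1 : a ^ (m - 1) ≤ δ ^ (m - 1) := Real.rpow_le_rpow_of_nonpos hδ h (by linarith)
    have h2 : a ^ m = a ^ (m - 1) * a := by
      rw [Real.rpow_sub_one ha'.ne', div_mul_cancel₀ _ ha'.ne']
    have h3 : 0 ≤ δ ^ m := by positivity
    rw [h2]
    linarith [mul_le_mul_of_nonneg_right h1 ha]

theorem rpow_mul_pow_le {a δ m z : ℝ} {j : ℕ} (ha : 0 ≤ a) (hδ : 0 < δ) (hm0 : 0 < m) (hm1 : m ≤ 1)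
    (hj : 1 ≤ j) (hjm : (j + 2) * m ≤ j) (hz0 : 0 ≤ z) (hz1 : z ≤ 1) :
    a ^ m * z ^ j ≤ δ ^ m + δ ^ (m - 1) * (a * z ^ (j + 2)) := by
  rcases hz0.eq_or_lt with rfl | hz
  · rw [zero_pow (by omega), zero_pow (by omega)]
    have : 0 ≤ δ ^ m := by positivity
    simpa using this
  · have h1 : z ^ j ≤ (z ^ (j + 2)) ^ m := by
      rw [← Real.rpow_natCast z j, ← Real.rpow_natCast z (j + 2), ← Real.rpow_mul hz0]
      refine Real.rpow_le_rpow_of_exponent_ge hz hz1 ?_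
      push_cast
      exact hjm
    calc a ^ m * z ^ j ≤ a ^ m * (z ^ (j + 2)) ^ m := by gcongr
      _ = (a * z ^ (j + 2)) ^ m := (Real.mul_rpow ha (by positivity)).symm
      _ ≤ _ := Real.rpow_le_rpow_add_rpow_sub_one_mul (by positivity) hδ hm0.le hm1

/-- A Gronwall-type bound for a function which vanishes at `0` and has increments controlled by its
supremum. -/
theorem le_of_sub_le_mul_of_tendsto_zero {y : ℝ → ℝ} {A K T : ℝ} (hy : ContinuousOn y (Set.Ioi 0))
    (hlim : Tendsto y (𝓝[>] 0) (𝓝 0)) (hA : 0 ≤ A) (hy0 : ∀ t > 0, 0 ≤ y t) (hK : 0 ≤ K)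
    (hKT : K * T ≤ 1 / 2)
    (hle : ∀ s t M, 0 < s → s ≤ t → (∀ τ ∈ Set.Icc s t, y τ ≤ M) →
      y t - y s ≤ K * (A + M) * (t - s))
    {t : ℝ} (ht : t ∈ Set.Ioc 0 T) : y t ≤ A := by
  have hc : ContinuousOn (Function.update y 0 0) (Set.Icc 0 T) := by
    intro τ hτ
    rcases hτ.1.eq_or_lt with rfl | h
    · rw [continuousWithinAt_update_same]
      exact hlim.mono_left (nhdsWithin_mono _ fun τ hτ => lt_of_le_of_ne hτ.1.1 (Ne.symm hτ.2))
    · rw [continuousWithinAt_update_of_ne h.ne']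
      exact (hy.continuousAt (Ioi_mem_nhds h)).continuousWithinAt
  obtain ⟨r, hr, hmax⟩ := isCompact_Icc.exists_isMaxOn ⟨t, ht.1.le, ht.2⟩ hc
  have hmax' : ∀ τ ∈ Set.Ioc 0 T, y τ ≤ Function.update y 0 0 r := fun τ hτ => by
    have := hmax (Set.Ioc_subset_Icc_self hτ)
    simpa [Function.update_of_ne hτ.1.ne'] using this
  rcases hr.1.eq_or_lt with rfl | hr0
  · simpa using (hmax' t ht).trans (by simpa using hA)
  rw [Function.update_of_ne hr0.ne'] at hmax'
  have hev : ∀ᶠ s in 𝓝[>] (0 : ℝ), y r ≤ y s + (A + y r) / 2 := by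
    filter_upwards [Ioo_mem_nhdsGT hr0] with s hs
    have h1 := hle s r (y r) hs.1 hs.2.le fun τ hτ => hmax' τ ⟨hs.1.trans_le hτ.1, hτ.2.trans hr.2⟩
    have h2 : 0 ≤ A + y r := add_nonneg hA (hy0 r hr0)
    have h3 : K * (r - s) ≤ 1 / 2 :=
      (mul_le_mul_of_nonneg_left (by linarith [hs.1, hr.2]) hK).trans hKT
    have h4 := mul_le_mul_of_nonneg_right h3 h2
    linarith
  have := ge_of_tendsto (hlim.add_const _) hev
  linarith [hmax' t ht]

variable {n : ℕ}

local notation "𝔼" => EuclideanSpace ℝ (Fin n)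

namespace IsFastDiffusionDifference

variable {m : ℝ} {d e : EuclideanSpace ℝ (Fin n) → ℝ → ℝ}

theorem integral_abs_mul_truncParaboloid_le (h : IsFastDiffusionDifference m d e)
    (hm : m ∈ Set.Ioo (0 : ℝ) 1) {j : ℕ} (hj : 1 ≤ j) (hjm : (j + 2) * m ≤ j) {R δ t : ℝ}
    (hR : 0 < R) (hδ : 0 < δ) (ht : 0 < t) :
    ∫ x, |e x t| * truncParaboloid j R x
      ≤ δ ^ m * volume.real (Metric.closedBall (0 : 𝔼) R)
        + δ ^ (m - 1) * ∫ x, |d x t| * truncParaboloid (j + 2) R x := by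
  have hz : ∀ k, 1 ≤ k → ∀ f : 𝔼 → ℝ, ∀ x ∉ Metric.closedBall (0 : 𝔼) R,
      |f x| * truncParaboloid k R x = 0 := by
    intro k hk f x hx
    rw [truncParaboloid_eq_zero hk hR, mul_zero]
    simpa using (not_le.1 fun h => hx (by simpa using h)).le
  have i1 := h.integrable_abs_mul ht continuous_truncParaboloid
    (hasCompactSupport_truncParaboloid (j := j + 2) (by omega) hR)
  have i2 : Integrable fun x => |e x t| * truncParaboloid j R x :=
    ((h.continuous_right ht).abs.mul continuous_truncParaboloid).integrable_of_hasCompactSupport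
      (hasCompactSupport_truncParaboloid hj hR).mul_left
  have i3 : Integrable (fun _ => δ ^ m) (volume.restrict (Metric.closedBall (0 : 𝔼) R)) :=
    integrableOn_const measure_closedBall_lt_top.ne
  have i4 : Integrable (fun x => δ ^ (m - 1) * (|d x t| * truncParaboloid (j + 2) R x))
      (volume.restrict (Metric.closedBall (0 : 𝔼) R)) := i1.integrableOn.const_mul _
  rw [← setIntegral_eq_integral_of_forall_compl_eq_zero (hz j hj fun x => e x t),
    ← setIntegral_eq_integral_of_forall_compl_eq_zero (hz (j + 2) (by omega) fun x => d x t)]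
  have e1 : δ ^ m * volume.real (Metric.closedBall (0 : 𝔼) R)
      + δ ^ (m - 1) * ∫ x in Metric.closedBall (0 : 𝔼) R, |d x t| * truncParaboloid (j + 2) R x
      = ∫ x in Metric.closedBall (0 : 𝔼) R,
          (δ ^ m + δ ^ (m - 1) * (|d x t| * truncParaboloid (j + 2) R x)) := by
    rw [integral_add i3 i4, integral_const_mul,
      setIntegral_const, smul_eq_mul, mul_comm (δ ^ m)]
  rw [e1]
  refine setIntegral_mono i2.integrableOn (i3.add i4) fun x => ?_
  exact (mul_le_mul_of_nonneg_right (h.abs_le x t ht) (truncParaboloid_nonneg x)).trans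
    (rpow_mul_pow_le (abs_nonneg _) hδ hm.1 hm.2.le hj hjm (le_max_right _ _)
      (max_one_sub_le_one x))

theorem continuousOn_integral_abs_mul (h : IsFastDiffusionDifference m d e) {φ : 𝔼 → ℝ}
    (hφ : Continuous φ) (hφc : HasCompactSupport φ) :
    ContinuousOn (fun t => ∫ x, |d x t| * φ x) (Set.Ioi 0) := by
  refine continuousOn_integral_of_compact_support hφc.isCompact ?_ ?_
  · have h1 : ContinuousOn (fun p : ℝ × 𝔼 => d p.2 p.1) (Set.Ioi 0 ×ˢ Set.univ) :=
      h.continuousOn_left.comp continuous_swap.continuousOn fun p hp => ⟨hp.2, hp.1⟩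
    exact h1.abs.mul (hφ.comp continuous_snd).continuousOn
  · intro p x _ hx
    rw [image_eq_zero_of_notMem_tsupport hx, mul_zero]

theorem tendsto_integral_abs_mul_truncParaboloid (h : IsFastDiffusionDifference m d e)
    (h0 : ∀ K : Set (EuclideanSpace ℝ (Fin n)), IsCompact K →
      Tendsto (fun t => ∫ x in K, |d x t|) (𝓝[>] 0) (𝓝 0)) {j : ℕ} (hj : 1 ≤ j) {R : ℝ}
    (hR : 0 < R) :
    Tendsto (fun t => ∫ x, |d x t| * truncParaboloid j R x) (𝓝[>] 0) (𝓝 0) := by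
  refine squeeze_zero' (Eventually.of_forall fun t =>
    integral_nonneg fun x => mul_nonneg (abs_nonneg _) (truncParaboloid_nonneg x)) ?_
    (h0 _ (isCompact_closedBall (0 : 𝔼) R))
  filter_upwards [self_mem_nhdsWithin] with t ht
  have hz : ∀ x ∉ Metric.closedBall (0 : 𝔼) R, |d x t| * truncParaboloid j R x = 0 := by
    intro x hx
    rw [truncParaboloid_eq_zero hj hR, mul_zero]
    simpa using (not_le.1 fun h => hx (by simpa using h)).le
  rw [← setIntegral_eq_integral_of_forall_compl_eq_zero hz]
  refine setIntegral_mono (h.integrable_abs_mul ht continuous_truncParaboloid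
    (hasCompactSupport_truncParaboloid hj hR)).integrableOn
    ((h.continuous_left ht).abs.continuousOn.integrableOn_compact (isCompact_closedBall _ _))
    fun x => ?_
  exact mul_le_of_le_one_right (abs_nonneg _) (truncParaboloid_le_one x)

/-- On a ball of large radius `R` the `L¹` distance is at most an arbitrarily small multiple of the
volume. -/
theorem integral_abs_mul_truncParaboloid_le_volume (h : IsFastDiffusionDifference m d e)
    (hm : m ∈ Set.Ioo (0 : ℝ) 1)
    (h0 : ∀ K : Set (EuclideanSpace ℝ (Fin n)), IsCompact K →
      Tendsto (fun t => ∫ x in K, |d x t|) (𝓝[>] 0) (𝓝 0)) {j : ℕ} (hj : 1 ≤ j)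
    (hjm : (j + 2) * m ≤ j) {R δ T : ℝ} (hR : 0 < R) (hδ : 0 < δ)
    (hRT : (4 * (j + 2) * (j + 1) + 2 * (j + 2) * n) / R ^ 2 * δ ^ (m - 1) * T ≤ 1 / 2)
    {t : ℝ} (ht : t ∈ Set.Ioc 0 T) :
    ∫ x, |d x t| * truncParaboloid (j + 2) R x
      ≤ δ * volume.real (Metric.closedBall (0 : 𝔼) R) := by
  have hc2 := hasCompactSupport_truncParaboloid (n := n) (j := j + 2) (by omega) hR
  refine le_of_sub_le_mul_of_tendsto_zero (h.continuousOn_integral_abs_mul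
    continuous_truncParaboloid hc2) (h.tendsto_integral_abs_mul_truncParaboloid h0 (by omega) hR)
    (by positivity) (fun t _ => integral_nonneg fun x =>
      mul_nonneg (abs_nonneg _) (truncParaboloid_nonneg x)) (by positivity) hRT ?_ ht
  intro s t M hs hst hM
  refine (h.integral_abs_sub_integral_abs_le hs hst (contDiff_truncParaboloid hj) hc2
    truncParaboloid_nonneg).trans ?_
  refine (le_abs_self _).trans ?_
  rw [← Real.norm_eq_abs, ← abs_of_nonneg (sub_nonneg.2 hst)]
  refine intervalIntegral.norm_integral_le_of_norm_le_const fun τ hτ => ?_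
  rw [Set.uIoc_of_le hst] at hτ
  have hτ0 : 0 < τ := hs.trans hτ.1
  have i2 : Integrable fun x => |e x τ| * truncParaboloid j R x :=
    ((h.continuous_right hτ0).abs.mul continuous_truncParaboloid).integrable_of_hasCompactSupport
      (hasCompactSupport_truncParaboloid hj hR).mul_left
  set C : ℝ := 4 * (j + 2) * (j + 1) + 2 * (j + 2) * n with hC
  have h1 : ‖∫ x, |e x τ| * laplacian (truncParaboloid (j + 2) R) x‖
      ≤ ∫ x, C / R ^ 2 * (|e x τ| * truncParaboloid j R x) := by
    refine norm_integral_le_of_norm_le (i2.const_mul _) (Eventually.of_forall fun x => ?_)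
    rw [norm_mul, Real.norm_eq_abs, Real.norm_eq_abs, abs_abs]
    have := mul_le_mul_of_nonneg_left (abs_laplacian_truncParaboloid_le hj hR x)
      (abs_nonneg (e x τ))
    rw [← hC] at this
    linarith
  rw [integral_const_mul] at h1
  have h2 := h.integral_abs_mul_truncParaboloid_le hm hj hjm hR hδ hτ0
  have h3 := hM τ ⟨hτ.1.le, hτ.2⟩
  have h4 : δ ^ m = δ ^ (m - 1) * δ := by
    rw [Real.rpow_sub_one hδ.ne', div_mul_cancel₀ _ hδ.ne']
  refine h1.trans ?_
  rw [mul_assoc]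
  refine mul_le_mul_of_nonneg_left (h2.trans ?_) (by positivity)
  rw [h4, mul_assoc, ← mul_add]
  gcongr

end IsFastDiffusionDifference

end Uniqueness

section Radius

variable {n j : ℕ} {W : EuclideanSpace ℝ (Fin n) → ℝ} {ρ : ℝ}

local notation "𝔼" => EuclideanSpace ℝ (Fin n)

theorem integrable_mul_truncParaboloid (hW : Continuous W) (hj : 1 ≤ j) (hρ : 0 < ρ) :
    Integrable fun x => W x * truncParaboloid j ρ x :=
  (hW.mul continuous_truncParaboloid).integrable_of_hasCompactSupport
    (hasCompactSupport_truncParaboloid hj hρ).mul_left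

theorem hasDerivAt_integral_mul_truncParaboloid (hW : Continuous W) (hj : 1 ≤ j) (hρ : 0 < ρ) :
    HasDerivAt (fun r => ∫ x, W x * truncParaboloid (j + 1) r x)
      (∫ x, W x * (2 * (j + 1) * ‖x‖ ^ 2 / ρ ^ 3 * truncParaboloid j ρ x)) ρ := by
  have hbc : Integrable fun x =>
      |W x| * (2 * (j + 1) * ‖x‖ ^ 2 / (ρ / 2) ^ 3) * truncParaboloid j (2 * ρ) x :=
    integrable_mul_truncParaboloid (by fun_prop) hj (by positivity)
  have hmeas : ∀ r, Continuous fun x => W x * truncParaboloid (j + 1) r x := fun r =>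
    hW.mul continuous_truncParaboloid
  refine (hasDerivAt_integral_of_dominated_loc_of_deriv_le
    (F' := fun r x => W x * (2 * (j + 1) * ‖x‖ ^ 2 / r ^ 3 * truncParaboloid j r x))
    (Ioo_mem_nhds (half_lt_self hρ) (by linarith : ρ < 2 * ρ))
    (Eventually.of_forall fun r => (hmeas r).aestronglyMeasurable)
    (integrable_mul_truncParaboloid hW (by omega) hρ) ?_ ?_ hbc ?_).2
  · have hc : Continuous (truncParaboloid j ρ : 𝔼 → ℝ) := continuous_truncParaboloid
    exact Continuous.aestronglyMeasurable (by fun_prop)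
  · refine Eventually.of_forall fun x r hr => ?_
    have hr0 : 0 < r := (half_pos hρ).trans hr.1
    rw [norm_mul, Real.norm_eq_abs, mul_assoc |W x|, Real.norm_of_nonneg
      (mul_nonneg (by positivity) (truncParaboloid_nonneg x))]
    have h1 := truncParaboloid_mono (j := j) hr0 hr.2.le x
    have h2 := hr.1.le
    have h3 := truncParaboloid_nonneg (j := j) (ρ := r) x
    gcongr
  · refine Eventually.of_forall fun x r hr => ?_
    exact (hasDerivAt_truncParaboloid_radius hj ((half_pos hρ).trans hr.1) x).const_mul _

theorem hasDerivAt_integral_mul_truncParaboloid_div_pow (hW : Continuous W) (hj : 1 ≤ j)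
    (hρ : 0 < ρ) :
    HasDerivAt (fun r => (∫ x, W x * truncParaboloid (j + 1) r x) / r ^ n)
      (ρ / (2 * (j + 2) * ρ ^ n) * ∫ x, W x * laplacian (truncParaboloid (j + 2) ρ) x) ρ := by
  have h1 := (hasDerivAt_integral_mul_truncParaboloid hW hj hρ).fun_div (hasDerivAt_pow n ρ)
    (by positivity)
  refine h1.congr_deriv ?_
  have i1 : Integrable fun x => W x * (2 * (j + 1) * ‖x‖ ^ 2 / ρ ^ 3 * truncParaboloid j ρ x) := by
    simp only [← mul_assoc]
    exact integrable_mul_truncParaboloid (by fun_prop) hj hρ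
  have i2 := integrable_mul_truncParaboloid hW (j := j + 1) (by omega) hρ
  have e1 : ∀ x, W x * laplacian (truncParaboloid (j + 2) ρ) x
      = 2 * (j + 2) / ρ * (W x * (2 * (j + 1) * ‖x‖ ^ 2 / ρ ^ 3 * truncParaboloid j ρ x))
        - 2 * (j + 2) * n / ρ ^ 2 * (W x * truncParaboloid (j + 1) ρ x) := by
    intro x
    rw [laplacian_truncParaboloid hj]
    field_simp
    ring
  simp only [e1]
  rw [integral_sub (i1.const_mul _) (i2.const_mul _), integral_const_mul, integral_const_mul]
  generalize (∫ x, W x * (2 * (j + 1) * ‖x‖ ^ 2 / ρ ^ 3 * truncParaboloid j ρ x)) = a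
  generalize (∫ x, W x * truncParaboloid (j + 1) ρ x) = b
  rcases n with _ | n
  · simp
    field_simp
  · simp only [Nat.add_sub_cancel]
    field_simp
    ring

end Radius

section Uniqueness

variable {n : ℕ}

local notation "𝔼" => EuclideanSpace ℝ (Fin n)

namespace IsFastDiffusionDifference

variable {m : ℝ} {d e : EuclideanSpace ℝ (Fin n) → ℝ → ℝ}

/-- Almost monotonicity in the radius of weighted averages of `∫ |e|` over balls. -/
theorem integral_mul_truncParaboloid_div_pow_le (h : IsFastDiffusionDifference m d e) (hn : 1 ≤ n)
    {j : ℕ} (hj : 1 ≤ j) {s t r R : ℝ} (hs : 0 < s) (hst : s ≤ t) (hr : 1 ≤ r) (hrR : r ≤ R) :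
    (∫ x, (∫ τ in s..t, |e x τ|) * truncParaboloid (j + 1) r x) / r ^ n
      ≤ (∫ x, (∫ τ in s..t, |e x τ|) * truncParaboloid (j + 1) R x) / R ^ n
        + (∫ x, |d x s| * truncParaboloid (j + 2) R x) * (R - r) := by
  set Y := ∫ x, |d x s| * truncParaboloid (j + 2) R x
  have hderiv := fun (ρ : ℝ) (hρ : 1 ≤ ρ) =>
    (hasDerivAt_integral_mul_truncParaboloid_div_pow (h.continuous_integral_abs hs hst) hj
      (zero_lt_one.trans_le hρ)).fun_add ((hasDerivAt_id' ρ).const_mul Y)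
  have hmono := monotoneOn_of_hasDerivWithinAt_nonneg (convex_Icc r R)
    (fun ρ hρ => (hderiv ρ (hr.trans hρ.1)).continuousAt.continuousWithinAt)
    (fun ρ hρ => (hderiv ρ (hr.trans (interior_subset hρ).1)).hasDerivWithinAt) fun ρ hρ => ?_
  · have := hmono (Set.left_mem_Icc.2 hrR) (Set.right_mem_Icc.2 hrR) hrR
    simp only at this
    linarith
  · have hρ' : ρ ∈ Set.Icc r R := interior_subset hρ
    have hρ1 : 1 ≤ ρ := hr.trans hρ'.1
    have hρ0 : 0 < ρ := zero_lt_one.trans_le hρ1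
    have hφ := contDiff_truncParaboloid (n := n) (ρ := ρ) hj
    have hφc := hasCompactSupport_truncParaboloid (n := n) (j := j + 2) (by omega) hρ0
    have h1 := h.integral_abs_sub_integral_abs_le hs hst hφ hφc truncParaboloid_nonneg
    rw [h.integral_integral_abs_mul_eq hs hst hφ.continuous_laplacian
      (HasCompactSupport.intro hφc fun x hx => HasCompactSupport.laplacian_eq_zero hx)] at h1
    have h2 : 0 ≤ ∫ x, |d x t| * truncParaboloid (j + 2) ρ x :=
      integral_nonneg fun x => mul_nonneg (abs_nonneg _) (truncParaboloid_nonneg x)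
    have h3 : ∫ x, |d x s| * truncParaboloid (j + 2) ρ x ≤ Y :=
      integral_mono (h.integrable_abs_mul hs continuous_truncParaboloid hφc)
        (h.integrable_abs_mul hs continuous_truncParaboloid
          (hasCompactSupport_truncParaboloid (by omega) (hρ0.trans_le hρ'.2)))
        fun x => mul_le_mul_of_nonneg_left (truncParaboloid_mono hρ0 hρ'.2 x) (abs_nonneg _)
    have h4 : 0 ≤ Y :=
      integral_nonneg fun x => mul_nonneg (abs_nonneg _) (truncParaboloid_nonneg x)
    have h5 : ρ / (2 * (j + 2) * ρ ^ n) ≤ 1 := by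
      rw [div_le_one (by positivity)]
      have := le_self_pow₀ hρ1 (by omega : n ≠ 0)
      nlinarith [(Nat.cast_nonneg j : (0 : ℝ) ≤ j)]
    have h6 : 0 ≤ ρ / (2 * (j + 2) * ρ ^ n) := by positivity
    nlinarith [mul_le_mul_of_nonneg_right h5 h4]

theorem integral_integral_abs_mul_truncParaboloid_le (h : IsFastDiffusionDifference m d e)
    (hm : m ∈ Set.Ioo (0 : ℝ) 1)
    (h0 : ∀ K : Set (EuclideanSpace ℝ (Fin n)), IsCompact K →
      Tendsto (fun t => ∫ x in K, |d x t|) (𝓝[>] 0) (𝓝 0)) {j : ℕ} (hj : 1 ≤ j)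
    (hjm : (j + 2) * m ≤ j) {R δ s T : ℝ} (hR : 0 < R) (hδ : 0 < δ)
    (hRT : (4 * (j + 2) * (j + 1) + 2 * (j + 2) * n) / R ^ 2 * δ ^ (m - 1) * T ≤ 1 / 2)
    (hs : 0 < s) (hsT : s ≤ T) :
    (∫ x, (∫ τ in s..T, |e x τ|) * truncParaboloid (j + 1) R x) / R ^ n
      ≤ 2 * T * volume.real (Metric.ball (0 : 𝔼) 1) * δ ^ m := by
  rw [← h.integral_integral_abs_mul_eq hs hsT continuous_truncParaboloid
    (hasCompactSupport_truncParaboloid (by omega) hR), div_le_iff₀ (by positivity)]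
  have hV : volume.real (Metric.closedBall (0 : 𝔼) R)
      = R ^ n * volume.real (Metric.ball (0 : 𝔼) 1) := by
    rw [Measure.addHaar_real_closedBall _ _ hR.le, finrank_euclideanSpace_fin]
  have h4 : δ ^ m = δ ^ (m - 1) * δ := by
    rw [Real.rpow_sub_one hδ.ne', div_mul_cancel₀ _ hδ.ne']
  have hb : ∀ τ ∈ Set.uIoc s T, ‖∫ x, |e x τ| * truncParaboloid (j + 1) R x‖
      ≤ 2 * δ ^ m * volume.real (Metric.closedBall (0 : 𝔼) R) := by
    intro τ hτ
    rw [Set.uIoc_of_le hsT] at hτ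
    have hτ0 : 0 < τ := hs.trans hτ.1
    rw [Real.norm_of_nonneg
      (integral_nonneg fun x => mul_nonneg (abs_nonneg _) (truncParaboloid_nonneg x))]
    have hW := (h.continuous_right hτ0).abs
    have h1 : ∫ x, |e x τ| * truncParaboloid (j + 1) R x ≤ ∫ x, |e x τ| * truncParaboloid j R x :=
      integral_mono (integrable_mul_truncParaboloid hW (by omega) hR)
        (integrable_mul_truncParaboloid hW hj hR)
        fun x => mul_le_mul_of_nonneg_left (truncParaboloid_succ_le x) (abs_nonneg _)
    have h2 := h.integral_abs_mul_truncParaboloid_le hm hj hjm hR hδ hτ0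
    have h3 := h.integral_abs_mul_truncParaboloid_le_volume hm h0 hj hjm hR hδ hRT ⟨hτ0, hτ.2⟩
    have h5 := mul_le_mul_of_nonneg_left h3 (by positivity : 0 ≤ δ ^ (m - 1))
    rw [← mul_assoc, ← h4] at h5
    linarith
  have := (le_abs_self _).trans (intervalIntegral.norm_integral_le_of_norm_le_const hb)
  rw [abs_of_nonneg (sub_nonneg.2 hsT), hV] at this
  refine this.trans ?_
  have h6 : T - s ≤ T := by linarith
  have h7 : 0 ≤ 2 * δ ^ m * (R ^ n * volume.real (Metric.ball (0 : 𝔼) 1)) := by positivity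
  linarith [mul_le_mul_of_nonneg_left h6 h7]

theorem integral_mul_truncParaboloid_nonpos (h : IsFastDiffusionDifference m d e) (hn : 1 ≤ n)
    (hm : m ∈ Set.Ioo (0 : ℝ) 1)
    (h0 : ∀ K : Set (EuclideanSpace ℝ (Fin n)), IsCompact K →
      Tendsto (fun t => ∫ x in K, |d x t|) (𝓝[>] 0) (𝓝 0)) {j : ℕ} (hj : 1 ≤ j)
    (hjm : (j + 2) * m ≤ j) {r s T : ℝ} (hr : 1 ≤ r) (hs : 0 < s) (hsT : s ≤ T) :
    ∫ x, (∫ τ in s..T, |e x τ|) * truncParaboloid (j + 1) r x ≤ 0 := by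
  have hr0 : 0 < r := zero_lt_one.trans_le hr
  have hT : 0 < T := hs.trans_le hsT
  set P : ℝ → ℝ := fun σ =>
    (∫ x, (∫ τ in σ..T, |e x τ|) * truncParaboloid (j + 1) r x) / r ^ n with hP
  suffices hPs : P s ≤ 0 by
    have := mul_nonpos_of_nonpos_of_nonneg hPs (by positivity : 0 ≤ r ^ n)
    rwa [hP, div_mul_cancel₀ _ (by positivity)] at this
  have hPmono : ∀ σ ∈ Set.Ioc 0 s, P s ≤ P σ := by
    intro σ hσ
    refine div_le_div_of_nonneg_right (integral_mono
      (integrable_mul_truncParaboloid (h.continuous_integral_abs hs hsT) (by omega) hr0)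
      (integrable_mul_truncParaboloid (h.continuous_integral_abs hσ.1 (hσ.2.trans hsT)) (by omega)
        hr0) fun x => mul_le_mul_of_nonneg_right ?_ (truncParaboloid_nonneg x)) (by positivity)
    refine intervalIntegral.integral_mono_interval hσ.2 hsT le_rfl
      (Eventually.of_forall fun τ => abs_nonneg _) ?_
    refine (h.continuousOn_right_time x).abs.mono ?_ |>.intervalIntegrable
    rw [Set.uIcc_of_le (hσ.2.trans hsT)]
    exact fun τ hτ => hσ.1.trans_le hτ.1
  have hPδ : ∀ δ > 0, P s ≤ 2 * T * volume.real (Metric.ball (0 : 𝔼) 1) * δ ^ m := by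
    intro δ hδ
    set X : ℝ := (4 * (j + 2) * (j + 1) + 2 * (j + 2) * n) * δ ^ (m - 1) * T with hX
    have hX0 : 0 ≤ X := by positivity
    set R : ℝ := r + 2 * X with hR
    have hrR : r ≤ R := by linarith
    have hR0 : 0 < R := hr0.trans_le hrR
    have hRT : (4 * (j + 2) * (j + 1) + 2 * (j + 2) * n) / R ^ 2 * δ ^ (m - 1) * T ≤ 1 / 2 := by
      rw [div_mul_eq_mul_div, div_mul_eq_mul_div, ← hX, div_le_iff₀ (by positivity)]
      nlinarith
    have hlim : Tendsto (fun σ => 2 * T * volume.real (Metric.ball (0 : 𝔼) 1) * δ ^ m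
        + (∫ x, |d x σ| * truncParaboloid (j + 2) R x) * (R - r)) (𝓝[>] 0)
        (𝓝 (2 * T * volume.real (Metric.ball (0 : 𝔼) 1) * δ ^ m + 0 * (R - r))) :=
      ((h.tendsto_integral_abs_mul_truncParaboloid h0 (by omega) hR0).mul_const _).const_add _
    rw [zero_mul, add_zero] at hlim
    refine ge_of_tendsto hlim ?_
    filter_upwards [Ioo_mem_nhdsGT hs] with σ hσ
    have hσT : σ ≤ T := hσ.2.le.trans hsT
    have h1 := h.integral_mul_truncParaboloid_div_pow_le hn hj hσ.1 hσT hr hrR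
    have h2 := h.integral_integral_abs_mul_truncParaboloid_le hm h0 hj hjm hR0 hδ hRT hσ.1 hσT
    exact (hPmono σ ⟨hσ.1, hσ.2.le⟩).trans (by linarith)
  have hlim : Tendsto (fun δ : ℝ => 2 * T * volume.real (Metric.ball (0 : 𝔼) 1) * δ ^ m) (𝓝[>] 0)
      (𝓝 (2 * T * volume.real (Metric.ball (0 : 𝔼) 1) * 0 ^ m)) :=
    ((Real.continuousAt_rpow_const 0 m (Or.inr hm.1.le)).tendsto.mono_left
      nhdsWithin_le_nhds).const_mul _
  rw [Real.zero_rpow hm.1.ne', mul_zero] at hlim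
  refine ge_of_tendsto hlim ?_
  filter_upwards [self_mem_nhdsWithin] with δ hδ using hPδ δ hδ

/-- If `d` vanishes in `L¹_loc` at the initial time, then `d = 0`. -/
theorem eq_zero (h : IsFastDiffusionDifference m d e) (hn : 1 ≤ n) (hm : m ∈ Set.Ioo (0 : ℝ) 1)
    (h0 : ∀ K : Set (EuclideanSpace ℝ (Fin n)), IsCompact K →
      Tendsto (fun t => ∫ x in K, |d x t|) (𝓝[>] 0) (𝓝 0)) (x : 𝔼) {t : ℝ} (ht : 0 < t) :
    d x t = 0 := by
  obtain ⟨k, hk⟩ := exists_nat_ge (2 * m / (1 - m))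
  have hjm : (((k + 1 : ℕ) : ℝ) + 2) * m ≤ ((k + 1 : ℕ) : ℝ) := by
    rw [div_le_iff₀ (by linarith [hm.2])] at hk
    push_cast
    linarith [hm.2]
  have hs : 0 < t / 2 := half_pos ht
  have hst : t / 2 < t := half_lt_self ht
  have hle := h.integral_mul_truncParaboloid_nonpos hn hm h0 (Nat.le_add_left 1 k) hjm
    (r := ‖x‖ + 1) (by linarith [norm_nonneg x]) hs hst.le
  have hr : 0 < ‖x‖ + 1 := by positivity
  have he : e x t = 0 := by
    by_contra hne
    refine hle.not_gt (Continuous.integral_pos_of_hasCompactSupport_nonneg_nonzero (x := x)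
      ((h.continuous_integral_abs hs hst.le).mul continuous_truncParaboloid)
      (hasCompactSupport_truncParaboloid (by omega) hr).mul_left ?_ ?_)
    · exact fun y => mul_nonneg
        (intervalIntegral.integral_nonneg hst.le fun τ _ => abs_nonneg _) (truncParaboloid_nonneg y)
    · refine mul_ne_zero (ne_of_gt ?_) (truncParaboloid_pos hr (by linarith)).ne'
      refine intervalIntegral.integral_pos hst
        ((h.continuousOn_right_time x).abs.mono fun τ hτ => hs.trans_le hτ.1)
        (fun τ _ => abs_nonneg _) ⟨t, Set.right_mem_Icc.2 hst.le, abs_pos.2 hne⟩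
  have := h.sign_eq x t ht
  rw [he, Real.sign_zero, eq_comm, Real.sign_eq_zero_iff] at this
  exact this

end IsFastDiffusionDifference

end Uniqueness

theorem Real.abs_rpow_sub_rpow_le {a b m : ℝ} (ha : 0 ≤ a) (hb : 0 ≤ b) (hm0 : 0 ≤ m)
    (hm1 : m ≤ 1) : |a ^ m - b ^ m| ≤ |a - b| ^ m := by
  wlog hba : b ≤ a generalizing a b
  · rw [abs_sub_comm, abs_sub_comm a]
    exact this hb ha (le_of_not_ge hba)
  have h1 := Real.rpow_add_le_add_rpow (sub_nonneg.2 hba) hb hm0 hm1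
  rw [sub_add_cancel] at h1
  rw [abs_of_nonneg (sub_nonneg.2 hba),
    abs_of_nonneg (sub_nonneg.2 (Real.rpow_le_rpow hb hba hm0))]
  linarith

theorem Real.sign_rpow_sub_rpow {a b m : ℝ} (ha : 0 ≤ a) (hb : 0 ≤ b) (hm : 0 < m) :
    Real.sign (a ^ m - b ^ m) = Real.sign (a - b) := by
  rcases lt_trichotomy a b with h | rfl | h
  · rw [Real.sign_of_neg (sub_neg.2 h), Real.sign_of_neg (sub_neg.2 (Real.rpow_lt_rpow ha h hm))]
  · simp
  · rw [Real.sign_of_pos (sub_pos.2 h), Real.sign_of_pos (sub_pos.2 (Real.rpow_lt_rpow hb h hm))]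

theorem stmt_16 (n : ℕ) (hn : 1 ≤ n) (m : ℝ) (hm : m ∈ Set.Ioo (0:ℝ) 1)
    (u v : EuclideanSpace ℝ (Fin n) → ℝ → ℝ)
    (hu_pos : ∀ x, ∀ t > (0:ℝ), 0 < u x t)
    (hv_pos : ∀ x, ∀ t > (0:ℝ), 0 < v x t)
    (hu_smooth : ContDiffOn ℝ (⊤ : ℕ∞) (fun q : EuclideanSpace ℝ (Fin n) × ℝ => u q.1 q.2)
      (Set.univ ×ˢ Set.Ioi 0))
    (hv_smooth : ContDiffOn ℝ (⊤ : ℕ∞) (fun q : EuclideanSpace ℝ (Fin n) × ℝ => v q.1 q.2)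
      (Set.univ ×ˢ Set.Ioi 0))
    (hu_eq : ∀ x, ∀ t > (0:ℝ),
      HasDerivAt (fun τ => u x τ) (laplacian (fun y => u y t ^ m) x) t)
    (hv_eq : ∀ x, ∀ t > (0:ℝ),
      HasDerivAt (fun τ => v x τ) (laplacian (fun y => v y t ^ m) x) t)
    (hinit : ∀ K : Set (EuclideanSpace ℝ (Fin n)), IsCompact K →
      Filter.Tendsto (fun t => ∫ x in K, |u x t - v x t|)
        (nhdsWithin 0 (Set.Ioi 0)) (nhds 0)) :
    ∀ x, ∀ t > (0:ℝ), u x t = v x t := by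
  have hopen : IsOpen (Set.univ ×ˢ Set.Ioi 0 : Set (EuclideanSpace ℝ (Fin n) × ℝ)) :=
    isOpen_univ.prod isOpen_Ioi
  have hum := hu_smooth.rpow_const_of_ne (p := m) fun q hq => (hu_pos q.1 q.2 hq.2).ne'
  have hvm := hv_smooth.rpow_const_of_ne (p := m) fun q hq => (hv_pos q.1 q.2 hq.2).ne'
  have hd := hu_smooth.sub hv_smooth
  have hslice : ∀ w : EuclideanSpace ℝ (Fin n) × ℝ → ℝ,
      ContDiffOn ℝ (⊤ : ℕ∞) w (Set.univ ×ˢ Set.Ioi 0) → ∀ t > 0,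
      ContDiff ℝ 2 fun x => w (x, t) := fun w hw t ht =>
    (hw.comp_contDiff (contDiff_id.prodMk contDiff_const) fun _ => ⟨Set.mem_univ _, ht⟩).of_le
      ENat.LEInfty.out
  have hderiv : ∀ x, ∀ t > 0, HasDerivAt (fun τ => u x τ - v x τ)
      (laplacian (fun y => u y t ^ m - v y t ^ m) x) t := by
    intro x t ht
    rw [laplacian_sub (hslice _ hum t ht) (hslice _ hvm t ht)]
    exact (hu_eq x t ht).fun_sub (hv_eq x t ht)
  have h : IsFastDiffusionDifference m (fun x t => u x t - v x t)
      (fun x t => u x t ^ m - v x t ^ m) :=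
    { continuousOn_left := hd.continuousOn
      continuousOn_right := (hum.sub hvm).continuousOn
      contDiff := hslice _ (hum.sub hvm)
      hasDerivAt := hderiv
      continuousOn_laplacian := by
        refine ((hd.continuousOn_fderiv_of_isOpen hopen (by simp)).clm_apply
          (continuousOn_const (c := ((0 : EuclideanSpace ℝ (Fin n)), (1 : ℝ))))).congr ?_
        rintro ⟨x, t⟩ hq
        have h1 := ((hd.differentiableOn (by simp)).differentiableAt
          (hopen.mem_nhds hq)).hasFDerivAt
        have h2 := h1.comp_hasDerivAt t ((hasDerivAt_const t x).prodMk (hasDerivAt_id t))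
        exact (hderiv x t hq.2).unique h2
      sign_eq := fun x t ht => Real.sign_rpow_sub_rpow (hu_pos x t ht).le (hv_pos x t ht).le hm.1
      abs_le := fun x t ht =>
        Real.abs_rpow_sub_rpow_le (hu_pos x t ht).le (hv_pos x t ht).le hm.1.le hm.2.le }
  exact fun x t ht => sub_eq_zero.1 (h.eq_zero hn hm hinit x ht)
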